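/- Let λ1, λ2, μ1, μ2 > 0 with ρ1 = λ1/μ1 < 1 and ρ1 + ρ2 < 1 where ρ2 = λ2/μ2, and let N ≥ 1 be an integer. Then for every fixed x ∈ (0,1): lim_{y→1⁻} L1(x,y) = ρ1·(1−ρ1)/(1−ρ1·x). Consequently, lim_{x→1⁻} lim_{y→1⁻} L1(x,y) = ρ1. -/

import Mathlib

open Real Filter Topology Set

noncomputable section

/-- The kernel discriminant Δ(y) = (λ+μ1−λ2·y)² − 4λ1μ1 with λ = λ1+λ2. -/
def Delta (l1 l2 m1 y : ℝ) : ℝ := (l1 + l2 + m1 - l2 * y) ^ 2 - 4 * l1 * m1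

/-- The small kernel root α(y) = x1(y). -/
def alphaf (l1 l2 m1 y : ℝ) : ℝ :=
  (l1 + l2 + m1 - l2 * y - Real.sqrt (Delta l1 l2 m1 y)) / (2 * l1)

/-- The large kernel root x2(y). -/
def x2f (l1 l2 m1 y : ℝ) : ℝ :=
  (l1 + l2 + m1 - l2 * y + Real.sqrt (Delta l1 l2 m1 y)) / (2 * l1)

/-- The kernel K(x,y) = λ1(1−x) + λ2(1−y) + μ1(1−1/x). -/
def Kker (l1 l2 m1 x y : ℝ) : ℝ :=
  l1 * (1 - x) + l2 * (1 - y) + m1 * (1 - 1 / x)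

/-- A(y) = y·a(y) = λ1·y + λ2·y(1−y) + μ2·(y−1). -/
def Afun (l1 l2 m2 y : ℝ) : ℝ := l1 * y + l2 * y * (1 - y) + m2 * (y - 1)

/-- β(y) = H(y)/H(1) where H(y) = Σ_{k<N} (r2·y)^k and r2 = λ2/(λ1+λ2). -/
def betaf (l1 l2 : ℝ) (N : ℕ) (y : ℝ) : ℝ :=
  (∑ k ∈ Finset.range N, (l2 / (l1 + l2) * y) ^ k) /
    (∑ k ∈ Finset.range N, (l2 / (l1 + l2) * 1) ^ k)

/-- L3(y) = β(y)(1−ρ1−ρ2). -/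
def L3f (l1 l2 m1 m2 : ℝ) (N : ℕ) (y : ℝ) : ℝ :=
  betaf l1 l2 N y * (1 - l1 / m1 - l2 / m2)

/-- L2(y) = [λ1(α(y)−1)+λ2(y−1)]·L3(y)/(A(y)−λ1·y·α(y)). -/
def L2f (l1 l2 m1 m2 : ℝ) (N : ℕ) (y : ℝ) : ℝ :=
  (l1 * (alphaf l1 l2 m1 y - 1) + l2 * (y - 1)) * L3f l1 l2 m1 m2 N y /
    (Afun l1 l2 m2 y - l1 * y * alphaf l1 l2 m1 y)

/-- L1(x,y) = λ1μ2(x−α(y))(y−1)·L3(y)/(x·K(x,y)·(A(y)−λ1·y·α(y))). -/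
def L1f (l1 l2 m1 m2 : ℝ) (N : ℕ) (x y : ℝ) : ℝ :=
  l1 * m2 * (x - alphaf l1 l2 m1 y) * (y - 1) * L3f l1 l2 m1 m2 N y /
    (x * Kker l1 l2 m1 x y * (Afun l1 l2 m2 y - l1 * y * alphaf l1 l2 m1 y))

/-- Λ(y) = α(y)·(y·L2(y)+L3(y))/(x2(y)−x1(y)). -/
def Lamf (l1 l2 m1 m2 : ℝ) (N : ℕ) (y : ℝ) : ℝ :=
  alphaf l1 l2 m1 y * (y * L2f l1 l2 m1 m2 N y + L3f l1 l2 m1 m2 N y) /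
    (x2f l1 l2 m1 y - alphaf l1 l2 m1 y)

/-- b1 = λ2/(λ2+(√μ1−√λ1)²). -/
def b1v (l1 l2 m1 : ℝ) : ℝ := l2 / (l2 + (Real.sqrt m1 - Real.sqrt l1) ^ 2)

/-- b2 = λ2/(λ2+(√μ1+√λ1)²). -/
def b2v (l1 l2 m1 : ℝ) : ℝ := l2 / (l2 + (Real.sqrt m1 + Real.sqrt l1) ^ 2)

/-- F(y) = λ2·y² − (1−2μ1+μ2)·y + 2μ2. -/
def Ff (l2 m1 m2 y : ℝ) : ℝ := l2 * y ^ 2 - (1 - 2 * m1 + m2) * y + 2 * m2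

/-- T*(y) = F(y) + y·√Δ(y). -/
def Tstar (l1 l2 m1 m2 y : ℝ) : ℝ :=
  Ff l2 m1 m2 y + y * Real.sqrt (Delta l1 l2 m1 y)

/-- T(y) = F(y) − y·√Δ(y). -/
def Tm (l1 l2 m1 m2 y : ℝ) : ℝ :=
  Ff l2 m1 m2 y - y * Real.sqrt (Delta l1 l2 m1 y)

/-- η1 = ((1−2μ1) + √((1−2μ1)²+4(μ1−μ2)λ2))/(2μ2). -/
def eta1 (l2 m1 m2 : ℝ) : ℝ :=
  (1 - 2 * m1 + Real.sqrt ((1 - 2 * m1) ^ 2 + 4 * (m1 - m2) * l2)) / (2 * m2)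

/-- η2 = ((1−2μ1) − √((1−2μ1)²+4(μ1−μ2)λ2))/(2μ2). -/
def eta2 (l2 m1 m2 : ℝ) : ℝ :=
  (1 - 2 * m1 - Real.sqrt ((1 - 2 * m1) ^ 2 + 4 * (m1 - m2) * l2)) / (2 * m2)

/-- a = ((1−ρ1−ρ2)/(2μ2))·η1/(η1−η2). -/
def av (l1 l2 m1 m2 : ℝ) : ℝ :=
  (1 - l1 / m1 - l2 / m2) / (2 * m2) * (eta1 l2 m1 m2 / (eta1 l2 m1 m2 - eta2 l2 m1 m2))

/-- b = ((1−ρ1−ρ2)/(2μ2))·η2/(η2−η1). -/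
def bv (l1 l2 m1 m2 : ℝ) : ℝ :=
  (1 - l1 / m1 - l2 / m2) / (2 * m2) * (eta2 l2 m1 m2 / (eta2 l2 m1 m2 - eta1 l2 m1 m2))

/-- ι(y) = (μ1−λ+λ2y−√Δ(y))/(2μ2(y−1)). -/
def iotaf (l1 l2 m1 m2 y : ℝ) : ℝ :=
  (m1 - (l1 + l2) + l2 * y - Real.sqrt (Delta l1 l2 m1 y)) / (2 * m2 * (y - 1))

/-- κ(y) = (2μ2(1−y) − (1−μ1y)·T(y))/(2μ1μ2·y(1−y)(1−ρ̄1·y)). -/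
def kappaf (l1 l2 m1 m2 y : ℝ) : ℝ :=
  (2 * m2 * (1 - y) - (1 - m1 * y) * Tm l1 l2 m1 m2 y) /
    (2 * m1 * m2 * y * (1 - y) * (1 - (l1 + l2) / m1 * y))

/-- c0 = ((λ+μ1) − √((λ+μ1)² − 4λ1μ1))/(2μ1). -/
def c0v (l1 l2 m1 : ℝ) : ℝ :=
  (l1 + l2 + m1 - Real.sqrt ((l1 + l2 + m1) ^ 2 - 4 * l1 * m1)) / (2 * m1)

/-- c1 = λ2·c0/√((λ+μ1)² − 4λ1μ1). -/
def c1v (l1 l2 m1 : ℝ) : ℝ :=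
  l2 * c0v l1 l2 m1 / Real.sqrt ((l1 + l2 + m1) ^ 2 - 4 * l1 * m1)

/-- D = (λ+μ1−2√(λ1μ1))(μ1−μ2−√(λ1μ1)) + λ2μ2. -/
def Dv (l1 l2 m1 m2 : ℝ) : ℝ :=
  (l1 + l2 + m1 - 2 * Real.sqrt (l1 * m1)) * (m1 - m2 - Real.sqrt (l1 * m1)) + l2 * m2

/-- K(η) = λ2·b1·√(1 − b2/b1)/(2·√(b1·b2)·(η − b1)). -/
def Kcv (l1 l2 m1 η : ℝ) : ℝ :=
  l2 * b1v l1 l2 m1 * Real.sqrt (1 - b2v l1 l2 m1 / b1v l1 l2 m1) /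
    (2 * Real.sqrt (b1v l1 l2 m1 * b2v l1 l2 m1) * (η - b1v l1 l2 m1))

/-- σ(η) = K(η)/(b1·√π). -/
def sigmav (l1 l2 m1 η : ℝ) : ℝ :=
  Kcv l1 l2 m1 η / (b1v l1 l2 m1 * Real.sqrt Real.pi)

/-- K1(η). -/
def K1v (l1 l2 m1 m2 η : ℝ) : ℝ :=
  l2 * b1v l1 l2 m1 * Real.sqrt (1 - b2v l1 l2 m1 / b1v l1 l2 m1) *
      ((1 - m1 / b1v l1 l2 m1) * (Ff l2 m1 m2 (1 / b1v l1 l2 m1) + 1)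
        - 2 * m2 * (1 - 1 / b1v l1 l2 m1)) /
    (4 * m1 * m2 * Real.sqrt (b1v l1 l2 m1 * b2v l1 l2 m1) * (1 - η / b1v l1 l2 m1) *
      (1 - 1 / b1v l1 l2 m1) * (1 - (l1 + l2) / m1 / b1v l1 l2 m1))

/-- σ1(η) = K1(η)/(b1·√π). -/
def sigma1v (l1 l2 m1 m2 η : ℝ) : ℝ :=
  K1v l1 l2 m1 m2 η / (b1v l1 l2 m1 * Real.sqrt Real.pi)

theorem alphaf_one {l1 m1 : ℝ} (l2 : ℝ) (hl1 : 0 < l1) (h : l1 < m1) :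
    alphaf l1 l2 m1 1 = 1 := by
  have hD : Delta l1 l2 m1 1 = (m1 - l1) ^ 2 := by unfold Delta; ring
  rw [alphaf, hD, Real.sqrt_sq (by linarith)]
  field_simp
  ring

theorem hasDerivAt_alphaf_one {l1 m1 : ℝ} (l2 : ℝ) (hl1 : 0 < l1) (h : l1 < m1) :
    HasDerivAt (alphaf l1 l2 m1) (l2 / (m1 - l1)) 1 := by
  have hpos : 0 < m1 - l1 := by linarith
  have hD : Delta l1 l2 m1 1 = (m1 - l1) ^ 2 := by unfold Delta; ring
  have hlin : HasDerivAt (fun y => l1 + l2 + m1 - l2 * y) (-(l2 * 1)) (1 : ℝ) :=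
    ((hasDerivAt_id' (1 : ℝ)).const_mul l2).const_sub _
  have hDelta : HasDerivAt (Delta l1 l2 m1) _ 1 := (hlin.pow 2).sub_const (4 * l1 * m1)
  have hsqrt := hDelta.sqrt (by rw [hD]; positivity)
  rw [hD, Real.sqrt_sq hpos.le] at hsqrt
  refine ((hlin.sub hsqrt).div_const (2 * l1)).congr_deriv ?_
  have := hpos.ne'
  field_simp
  ring

theorem continuous_betaf (l1 l2 : ℝ) (N : ℕ) : Continuous (betaf l1 l2 N) := by
  unfold betaf
  fun_prop

theorem betaf_one {l1 l2 : ℝ} (hl1 : 0 < l1) (hl2 : 0 < l2) {N : ℕ} (hN : 1 ≤ N) :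
    betaf l1 l2 N 1 = 1 :=
  div_self (Finset.sum_pos (fun _ _ => by positivity)
    (Finset.nonempty_range_iff.mpr (by omega))).ne'

/-- The common factor `y - 1` cancels from `L1`. -/
theorem L1f_eq_slope {l1 m1 : ℝ} (l2 m2 : ℝ) (hl1 : 0 < l1) (h : l1 < m1) (N : ℕ) (x : ℝ)
    {y : ℝ} (hy : y ≠ 1) :
    L1f l1 l2 m1 m2 N x y =
      l1 * m2 * (x - alphaf l1 l2 m1 y) * L3f l1 l2 m1 m2 N y /
        (x * Kker l1 l2 m1 x y * (m2 - l2 * y - l1 * y * slope (alphaf l1 l2 m1) 1 y)) := by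
  have hy' : y - 1 ≠ 0 := sub_ne_zero.mpr hy
  have hA : Afun l1 l2 m2 y - l1 * y * alphaf l1 l2 m1 y =
      (m2 - l2 * y - l1 * y * slope (alphaf l1 l2 m1) 1 y) * (y - 1) := by
    rw [slope_def_field, alphaf_one l2 hl1 h, Afun]
    field_simp
    ring
  rw [L1f, hA, ← mul_assoc, mul_right_comm _ (y - 1), mul_div_mul_right _ _ hy']

/-- Equation (43): `lim_{y→1⁻} L1(x,y) = ρ1(1−ρ1)/(1−ρ1·x)` for `x ∈ (0,1)`,
and consequently `lim_{x→1⁻} lim_{y→1⁻} L1(x,y) = ρ1`. -/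
theorem stmt7 (l1 l2 m1 m2 : ℝ) (hl1 : 0 < l1) (hl2 : 0 < l2) (hm1 : 0 < m1) (hm2 : 0 < m2)
    (hr1 : l1 / m1 < 1) (hr : l1 / m1 + l2 / m2 < 1) (N : ℕ) (hN : 1 ≤ N) :
    (∀ x ∈ Ioo (0:ℝ) 1,
      Tendsto (fun y => L1f l1 l2 m1 m2 N x y) (𝓝[<] (1:ℝ))
        (𝓝 (l1 / m1 * (1 - l1 / m1) / (1 - l1 / m1 * x)))) ∧
    Tendsto (fun x => l1 / m1 * (1 - l1 / m1) / (1 - l1 / m1 * x)) (𝓝[<] (1:ℝ))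
      (𝓝 (l1 / m1)) := by
  have h : l1 < m1 := (div_lt_one hm1).mp hr1
  have hpos : 0 < m1 - l1 := by linarith
  refine ⟨fun x ⟨hx0, hx1⟩ => ?_, ?_⟩
  · have hx : 0 < m1 - l1 * x := by nlinarith
    have hload : 0 < 1 - l1 / m1 - l2 / m2 := by linarith
    have hslope : Tendsto (slope (alphaf l1 l2 m1) 1) (𝓝[<] 1) (𝓝 (l2 / (m1 - l1))) :=
      (hasDerivAt_iff_tendsto_slope.mp (hasDerivAt_alphaf_one l2 hl1 h)).mono_left
        (nhdsWithin_mono _ fun _ hy => ne_of_lt hy)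
    have hα : Tendsto (alphaf l1 l2 m1) (𝓝[<] 1) (𝓝 1) := by
      have := (hasDerivAt_alphaf_one l2 hl1 h).continuousAt.tendsto
      rw [alphaf_one l2 hl1 h] at this
      exact this.mono_left nhdsWithin_le_nhds
    have hL3 : Tendsto (L3f l1 l2 m1 m2 N) (𝓝[<] 1) (𝓝 (1 - l1 / m1 - l2 / m2)) := by
      have := ((continuous_betaf l1 l2 N).tendsto 1).mul_const (1 - l1 / m1 - l2 / m2)
      rw [betaf_one hl1 hl2 hN, one_mul] at this
      exact this.mono_left nhdsWithin_le_nhds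
    have hK : Tendsto (Kker l1 l2 m1 x) (𝓝[<] 1) (𝓝 (Kker l1 l2 m1 x 1)) := by
      have : Continuous (Kker l1 l2 m1 x) := by unfold Kker; fun_prop
      exact (this.tendsto 1).mono_left nhdsWithin_le_nhds
    have hy : Tendsto (fun y : ℝ => y) (𝓝[<] 1) (𝓝 1) := nhdsWithin_le_nhds
    have hxK : x * Kker l1 l2 m1 x 1 = -((1 - x) * (m1 - l1 * x)) := by
      unfold Kker
      field_simp
      ring
    have hden : m2 - l2 * 1 - l1 * 1 * (l2 / (m1 - l1)) =
        m2 * m1 / (m1 - l1) * (1 - l1 / m1 - l2 / m2) := by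
      have := hpos.ne'
      field_simp
      ring
    have h1x : 0 < 1 - x := by linarith
    have hne : x * Kker l1 l2 m1 x 1 * (m2 - l2 * 1 - l1 * 1 * (l2 / (m1 - l1))) ≠ 0 := by
      rw [hxK, hden]
      exact mul_ne_zero (neg_ne_zero.mpr (by positivity)) (by positivity)
    have hlim := (((hα.const_sub x).const_mul (l1 * m2)).mul hL3).div
      ((hK.const_mul x).mul (((hy.const_mul l2).const_sub m2).sub
        ((hy.const_mul l1).mul hslope))) hne
    have hval : l1 * m2 * (x - 1) * (1 - l1 / m1 - l2 / m2) /
        (x * Kker l1 l2 m1 x 1 * (m2 - l2 * 1 - l1 * 1 * (l2 / (m1 - l1)))) =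
        l1 / m1 * (1 - l1 / m1) / (1 - l1 / m1 * x) := by
      have hx' : 1 - l1 / m1 * x = (m1 - l1 * x) / m1 := by field_simp
      have hr' : 1 - l1 / m1 = (m1 - l1) / m1 := by field_simp
      rw [hxK, hden, hx']
      generalize 1 - l1 / m1 - l2 / m2 = c at hload ⊢
      rw [hr']
      have := hpos.ne'
      have := hx.ne'
      have := h1x.ne'
      have := hload.ne'
      field_simp
      ring
    rw [hval] at hlim
    refine hlim.congr' ?_
    filter_upwards [self_mem_nhdsWithin] with y hy
    exact (L1f_eq_slope l2 m2 hl1 h N x (ne_of_lt hy)).symm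
  · have hne : 1 - l1 / m1 * 1 ≠ 0 := by linarith
    have hx : Tendsto (fun x : ℝ => x) (𝓝[<] 1) (𝓝 1) := nhdsWithin_le_nhds
    have hlim := (tendsto_const_nhds (x := l1 / m1 * (1 - l1 / m1))).div
      ((hx.const_mul (l1 / m1)).const_sub 1) hne
    rwa [mul_one, mul_div_cancel_right₀ _ (by linarith)] at hlim

end
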